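/- arXiv:2103.06182 — 4 statements merged into one kernel-verified Lean document; each statement's English description precedes it below -/
import Mathlib

section
/- Let x, y ∈ ℝ³, let v ∈ ℝ³ be a unit vector, and θ ∈ (0, π/2). If ⟨v, x − y⟩ ≤ −‖x − y‖ sin θ, then for every z in the cone K(y,v,θ) one has ‖x − z‖ ≥ ‖x − y‖; in particular the apex y, which belongs to K(y,v,θ), attains the shortest distance from x to K(y,v,θ). -/
open Matrix RealInnerProductSpace

section InnerProduct

variable {E : Type*} [NormedAddCommGroup E] [InnerProductSpace ℝ E]

lemma inner_sub_inner_smul_sub_inner_smul {v : E} (hv : ‖v‖ = 1) (a w : E) :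
    ⟪a - ⟪v, a⟫ • v, w - ⟪v, w⟫ • v⟫ = ⟪a, w⟫ - ⟪v, a⟫ * ⟪v, w⟫ := by
  simp only [inner_sub_left, inner_sub_right, real_inner_smul_left, real_inner_smul_right,
    real_inner_self_eq_norm_sq, hv, real_inner_comm v a]
  ring

lemma norm_sub_inner_smul_sq {v : E} (hv : ‖v‖ = 1) (a : E) :
    ‖a - ⟪v, a⟫ • v‖ ^ 2 = ‖a‖ ^ 2 - ⟪v, a⟫ ^ 2 := by
  rw [← real_inner_self_eq_norm_sq, inner_sub_inner_smul_sub_inner_smul hv,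
    real_inner_self_eq_norm_sq, sq ⟪v, a⟫]

/-- A vector of the polar cone has nonpositive inner product with every vector on the cone. -/
lemma inner_nonpos_of_inner_axis_le {v a w : E} (hv : ‖v‖ = 1) {θ : ℝ}
    (hs : 0 ≤ Real.sin θ) (hc : 0 ≤ Real.cos θ)
    (ha : ⟪v, a⟫ ≤ -(‖a‖ * Real.sin θ)) (hw : ⟪v, w⟫ = Real.cos θ * ‖w‖) :
    ⟪a, w⟫ ≤ 0 := by
  have hsc := Real.sin_sq_add_cos_sq θ
  have hpa : ‖a - ⟪v, a⟫ • v‖ ≤ Real.cos θ * ‖a‖ := by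
    refine (sq_le_sq₀ (norm_nonneg _) (by positivity)).1 ?_
    have hsq : (‖a‖ * Real.sin θ) ^ 2 ≤ (-⟪v, a⟫) ^ 2 :=
      pow_le_pow_left₀ (by positivity) (by linarith) 2
    rw [norm_sub_inner_smul_sq hv]
    linear_combination hsq - ‖a‖ ^ 2 * hsc
  have hpw : ‖w - ⟪v, w⟫ • v‖ ≤ Real.sin θ * ‖w‖ := by
    refine (sq_le_sq₀ (norm_nonneg _) (by positivity)).1 ?_
    rw [norm_sub_inner_smul_sq hv, hw]
    linear_combination - ‖w‖ ^ 2 * hsc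
  have hperp := (real_inner_le_norm (a - ⟪v, a⟫ • v) (w - ⟪v, w⟫ • v)).trans
    (mul_le_mul hpa hpw (norm_nonneg _) (by positivity))
  have haxis : ⟪v, a⟫ * ⟪v, w⟫ ≤ -(‖a‖ * Real.sin θ) * (Real.cos θ * ‖w‖) := by
    rw [hw]
    exact mul_le_mul_of_nonneg_right ha (by positivity)
  rw [inner_sub_inner_smul_sub_inner_smul hv] at hperp
  linear_combination hperp + haxis

lemma norm_le_norm_sub_of_inner_nonpos {a w : E} (h : ⟪a, w⟫ ≤ 0) : ‖a‖ ≤ ‖a - w‖ := by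
  refine (sq_le_sq₀ (norm_nonneg _) (norm_nonneg _)).1 ?_
  rw [norm_sub_sq_real]
  linarith [sq_nonneg ‖w‖]

end InnerProduct

/-- **Point-Cone shortest distance, dual-cone case** (Theorem 1, case 6, first case).
Let `K(y,v,θ) = {z : ⟨v, z − y⟩ = cos θ ‖z − y‖}` be the cone with apex `y`, unit axis `v`
and half angle `θ ∈ (0, π/2)`. If `⟨v, x − y⟩ ≤ −‖x − y‖ sin θ` (i.e. `x` lies in the dual
cone), then the apex `y` belongs to the cone and attains the shortest distance from `x`. -/
theorem point_cone_dual_case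
    (x y v : EuclideanSpace ℝ (Fin 3)) (hv : ‖v‖ = 1)
    (θ : ℝ) (hθ : θ ∈ Set.Ioo 0 (Real.pi / 2))
    (hdual : ⟪v, x - y⟫ ≤ -(‖x - y‖ * Real.sin θ)) :
    y ∈ {z : EuclideanSpace ℝ (Fin 3) | ⟪v, z - y⟫ = Real.cos θ * ‖z - y‖} ∧
    ∀ z ∈ {z : EuclideanSpace ℝ (Fin 3) | ⟪v, z - y⟫ = Real.cos θ * ‖z - y‖},
      ‖x - y‖ ≤ ‖x - z‖ := by
  refine ⟨by simp, fun z hz => ?_⟩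
  have hs : 0 ≤ Real.sin θ :=
    Real.sin_nonneg_of_nonneg_of_le_pi hθ.1.le (by linarith [hθ.2, Real.pi_pos])
  have hc : 0 ≤ Real.cos θ :=
    Real.cos_nonneg_of_mem_Icc ⟨by linarith [hθ.1, Real.pi_pos], hθ.2.le⟩
  simpa using norm_le_norm_sub_of_inner_nonpos
    (inner_nonpos_of_inner_axis_le hv hs hc hdual hz)
end

section
/- Let A be a 3×3 real symmetric positive definite matrix, and let x, y ∈ ℝ³ with x_y = x − y satisfying x_yᵀ A x_y > 1 (i.e., x lies strictly outside the ellipsoid E(y,A)). For λ ≥ 0 define z(λ) = (λ A + I)⁻¹ x_y and g(λ) = z(λ)ᵀ A z(λ) − 1. Then: (i) g is strictly decreasing on [0, ∞), with derivative g′(λ) = −2 z(λ)ᵀ A (λ A + I)⁻¹ A z(λ) < 0; (ii) g(0) = x_yᵀ A x_y − 1 > 0; (iii) g(λ) → −1 as λ → ∞; and consequently (iv) there exists a unique λ* > 0 with g(λ*) = 0. -/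
open Matrix Filter

namespace Matrix

variable {n : Type*}

theorem PosDef.smul_add_one [DecidableEq n] {A : Matrix n n ℝ} (hA : A.PosDef) {l : ℝ} (hl : 0 ≤ l) :
    (l • A + 1).PosDef :=
  PosDef.posSemidef_add (hA.posSemidef.smul hl) PosDef.one

variable [Fintype n]

theorem IsHermitian.dotProduct_mulVec_comm {A : Matrix n n ℝ} (hA : A.IsHermitian) (u v : n → ℝ) :
    u ⬝ᵥ A *ᵥ v = v ⬝ᵥ A *ᵥ u := by
  have h : Aᵀ = A := by simpa [IsHermitian] using hA
  rw [dotProduct_mulVec, dotProduct_comm, ← mulVec_transpose, h]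

theorem IsHermitian.quadratic_sub_quadratic {A : Matrix n n ℝ} (hA : A.IsHermitian) (u v : n → ℝ) :
    u ⬝ᵥ A *ᵥ u - v ⬝ᵥ A *ᵥ v = (u - v) ⬝ᵥ A *ᵥ (u + v) := by
  rw [mulVec_add, dotProduct_add, sub_dotProduct, sub_dotProduct, hA.dotProduct_mulVec_comm v u]
  ring

variable [DecidableEq n]

theorem continuousAt_inv_smul_add_one (A : Matrix n n ℝ) {l : ℝ} (h : (l • A + 1).det ≠ 0) :
    ContinuousAt (fun t : ℝ => (t • A + 1)⁻¹) l := by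
  have hc : Continuous fun t : ℝ => t • A + 1 := by fun_prop
  refine ContinuousAt.comp (f := fun t : ℝ => t • A + 1) (g := Inv.inv)
    (continuousAt_matrix_inv _ ?_) hc.continuousAt
  rw [Ring.inverse_eq_inv']
  exact continuousAt_inv₀ h

/-- The resolvent identity for `(t A + I)⁻¹ w`. -/
theorem inv_smul_add_one_mulVec_sub (A : Matrix n n ℝ) {t l : ℝ} (ht : (t • A + 1).det ≠ 0)
    (hl : (l • A + 1).det ≠ 0) (w : n → ℝ) :
    (t • A + 1)⁻¹ *ᵥ w - (l • A + 1)⁻¹ *ᵥ w =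
      -(t - l) • ((t • A + 1)⁻¹ *ᵥ (A *ᵥ ((l • A + 1)⁻¹ *ᵥ w))) := by
  set v := (l • A + 1)⁻¹ *ᵥ w with hv
  have hw : w = (l • A + 1) *ᵥ v := by
    rw [hv, mulVec_mulVec, mul_nonsing_inv _ hl.isUnit, one_mulVec]
  have hv' : v = (t • A + 1)⁻¹ *ᵥ ((t • A + 1) *ᵥ v) := by
    rw [mulVec_mulVec, nonsing_inv_mul _ ht.isUnit, one_mulVec]
  rw [hw]
  nth_rw 2 [hv']
  rw [← mulVec_sub, ← sub_mulVec, ← mulVec_smul, ← smul_mulVec]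
  congr 2
  module

theorem IsHermitian.hasDerivAt_quadratic_resolvent {A : Matrix n n ℝ} (hA : A.IsHermitian)
    {l : ℝ} (hl : (l • A + 1).det ≠ 0) (w : n → ℝ) :
    HasDerivAt (fun t : ℝ => ((t • A + 1)⁻¹ *ᵥ w) ⬝ᵥ A *ᵥ ((t • A + 1)⁻¹ *ᵥ w))
      (-(2 * (((l • A + 1)⁻¹ *ᵥ w) ⬝ᵥ
        A *ᵥ ((l • A + 1)⁻¹ *ᵥ (A *ᵥ ((l • A + 1)⁻¹ *ᵥ w)))))) l := by
  have hR := continuousAt_inv_smul_add_one A hl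
  have hdet : ∀ᶠ t in nhds l, (t • A + 1).det ≠ 0 := by
    have hc : Continuous fun t : ℝ => (t • A + 1).det := by fun_prop
    exact hc.continuousAt.eventually_ne hl
  have hmul (u : n → ℝ) : ContinuousAt (fun t : ℝ => (t • A + 1)⁻¹ *ᵥ u) l :=
    ContinuousAt.comp (g := fun M : Matrix n n ℝ => M *ᵥ u)
      (continuous_id.matrix_mulVec continuous_const).continuousAt hR
  set v := (l • A + 1)⁻¹ *ᵥ w with hv
  have hcont : ContinuousAt (fun t : ℝ =>
      -(((t • A + 1)⁻¹ *ᵥ (A *ᵥ v)) ⬝ᵥ A *ᵥ ((t • A + 1)⁻¹ *ᵥ w + v))) l := by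
    have hq : Continuous fun p : (n → ℝ) × (n → ℝ) => -(p.1 ⬝ᵥ A *ᵥ (p.2 + v)) :=
      (continuous_fst.dotProduct
        (continuous_const.matrix_mulVec (continuous_snd.add continuous_const))).neg
    exact ContinuousAt.comp (g := fun p : (n → ℝ) × (n → ℝ) => -(p.1 ⬝ᵥ A *ᵥ (p.2 + v)))
      hq.continuousAt ((hmul (A *ᵥ v)).prodMk (hmul w))
  rw [hasDerivAt_iff_tendsto_slope]
  have hlim := hcont.tendsto.mono_left (nhdsWithin_le_nhds (s := {l}ᶜ))
  rw [← hv] at hlim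
  have hval : -(((l • A + 1)⁻¹ *ᵥ (A *ᵥ v)) ⬝ᵥ A *ᵥ (v + v)) =
      -(2 * (v ⬝ᵥ A *ᵥ ((l • A + 1)⁻¹ *ᵥ (A *ᵥ v)))) := by
    rw [mulVec_add, dotProduct_add, hA.dotProduct_mulVec_comm _ v]
    ring
  rw [hval] at hlim
  refine hlim.congr' ?_
  filter_upwards [nhdsWithin_le_nhds hdet, self_mem_nhdsWithin] with t ht htl
  have htl' : t - l ≠ 0 := sub_ne_zero.mpr htl
  rw [slope_def_field, ← hv, hA.quadratic_sub_quadratic, hv,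
    inv_smul_add_one_mulVec_sub A ht hl, smul_dotProduct, smul_eq_mul]
  field_simp

theorem PosDef.quadratic_resolvent_deriv_pos {A : Matrix n n ℝ} (hA : A.PosDef) {l : ℝ}
    (hl : 0 ≤ l) {w : n → ℝ} (hw : w ≠ 0) :
    0 < ((l • A + 1)⁻¹ *ᵥ w) ⬝ᵥ A *ᵥ ((l • A + 1)⁻¹ *ᵥ (A *ᵥ ((l • A + 1)⁻¹ *ᵥ w))) := by
  have hM := (hA.smul_add_one hl).inv
  have hz : (l • A + 1)⁻¹ *ᵥ w ≠ 0 := fun h => by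
    simpa [h] using hM.dotProduct_mulVec_pos hw
  have hAz : A *ᵥ ((l • A + 1)⁻¹ *ᵥ w) ≠ 0 := fun h => by
    simpa [h] using hA.dotProduct_mulVec_pos hz
  rw [hA.isHermitian.dotProduct_mulVec_comm, dotProduct_comm]
  simpa using hM.dotProduct_mulVec_pos hAz

theorem PosDef.mul_quadratic_resolvent_le {A : Matrix n n ℝ} (hA : A.PosDef) {l : ℝ}
    (hl : 0 ≤ l) (w : n → ℝ) :
    l * (((l • A + 1)⁻¹ *ᵥ w) ⬝ᵥ A *ᵥ ((l • A + 1)⁻¹ *ᵥ w)) ≤ w ⬝ᵥ w := by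
  set v := (l • A + 1)⁻¹ *ᵥ w with hv
  have hw : l • (A *ᵥ v) + v = w := by
    have hdet := (hA.smul_add_one hl).det_pos.ne'.isUnit
    rw [← smul_mulVec]
    nth_rw 2 [← one_mulVec v]
    rw [← add_mulVec, hv, mulVec_mulVec, mul_nonsing_inv _ hdet, one_mulVec]
  have hvw : l * (v ⬝ᵥ A *ᵥ v) + v ⬝ᵥ v = v ⬝ᵥ w := by
    rw [← smul_eq_mul, ← dotProduct_smul, ← dotProduct_add, hw]
  have hnonneg (u : n → ℝ) : 0 ≤ u ⬝ᵥ u := by simpa using dotProduct_star_self_nonneg u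
  have h1 := hnonneg (v - w)
  rw [sub_dotProduct, dotProduct_sub, dotProduct_sub, dotProduct_comm w v] at h1
  linarith [hnonneg v, hnonneg w]

theorem PosDef.tendsto_quadratic_resolvent {A : Matrix n n ℝ} (hA : A.PosDef) (w : n → ℝ) :
    Tendsto (fun l : ℝ => ((l • A + 1)⁻¹ *ᵥ w) ⬝ᵥ A *ᵥ ((l • A + 1)⁻¹ *ᵥ w)) atTop (nhds 0) := by
  refine squeeze_zero' (Eventually.of_forall fun l => ?_) ?_
    (tendsto_id.const_div_atTop (w ⬝ᵥ w))
  · simpa using hA.posSemidef.dotProduct_mulVec_nonneg ((l • A + 1)⁻¹ *ᵥ w)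
  · filter_upwards [eventually_gt_atTop 0] with l hl
    rw [id, le_div_iff₀' hl]
    exact hA.mul_quadratic_resolvent_le hl.le w

end Matrix

/-- **Point-Ellipsoid root function** (Theorem 1, case 7, root function).
Let `A` be a symmetric positive definite 3×3 matrix and `x, y ∈ ℝ³` with
`x_y = x − y` strictly outside the ellipsoid, i.e. `x_yᵀ A x_y > 1`.
With `z(λ) = (λA + I)⁻¹ x_y` and `g(λ) = z(λ)ᵀ A z(λ) − 1`:
(i) `g` has derivative `g′(λ) = −2 z(λ)ᵀ A (λA + I)⁻¹ A z(λ) < 0` for `λ ≥ 0` and is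
strictly decreasing on `[0, ∞)`; (ii) `g(0) = x_yᵀ A x_y − 1 > 0`;
(iii) `g(λ) → −1` as `λ → ∞`; (iv) `g` has a unique root `λ* > 0`. -/
theorem point_ellipsoid_root_function
    (A : Matrix (Fin 3) (Fin 3) ℝ) (hA : A.PosDef)
    (x y : Fin 3 → ℝ) (hout : 1 < (x - y) ⬝ᵥ A.mulVec (x - y))
    (z : ℝ → Fin 3 → ℝ) (hz : ∀ l : ℝ, z l = (l • A + 1)⁻¹.mulVec (x - y))
    (g : ℝ → ℝ) (hg : ∀ l : ℝ, g l = z l ⬝ᵥ A.mulVec (z l) - 1) :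
    (∀ l : ℝ, 0 ≤ l →
      HasDerivAt g (-(2 * (z l ⬝ᵥ A.mulVec ((l • A + 1)⁻¹.mulVec (A.mulVec (z l)))))) l ∧
      -(2 * (z l ⬝ᵥ A.mulVec ((l • A + 1)⁻¹.mulVec (A.mulVec (z l))))) < 0) ∧
    StrictAntiOn g (Set.Ici 0) ∧
    (g 0 = (x - y) ⬝ᵥ A.mulVec (x - y) - 1 ∧ 0 < g 0) ∧
    Tendsto g atTop (nhds (-1)) ∧
    (∃! l : ℝ, 0 < l ∧ g l = 0) := by
  have hw : x - y ≠ 0 := by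
    intro h
    rw [h, zero_dotProduct] at hout
    linarith
  have hgf : g = fun l : ℝ => ((l • A + 1)⁻¹ *ᵥ (x - y)) ⬝ᵥ
      A *ᵥ ((l • A + 1)⁻¹ *ᵥ (x - y)) - 1 := by
    funext l
    rw [hg, hz]
  have hderiv : ∀ l : ℝ, 0 ≤ l →
      HasDerivAt g (-(2 * (z l ⬝ᵥ A.mulVec ((l • A + 1)⁻¹.mulVec (A.mulVec (z l)))))) l ∧
      -(2 * (z l ⬝ᵥ A.mulVec ((l • A + 1)⁻¹.mulVec (A.mulVec (z l))))) < 0 := by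
    intro l hl
    rw [hgf, hz]
    refine ⟨(hA.isHermitian.hasDerivAt_quadratic_resolvent
      (hA.smul_add_one hl).det_pos.ne' (x - y)).sub_const 1, ?_⟩
    have := hA.quadratic_resolvent_deriv_pos hl hw
    linarith
  have hcont : ContinuousOn g (Set.Ici 0) := fun l hl =>
    (hderiv l hl).1.continuousAt.continuousWithinAt
  have hanti : StrictAntiOn g (Set.Ici 0) := by
    refine strictAntiOn_of_deriv_neg (convex_Ici 0) hcont fun l hl => ?_
    have hl' : l ∈ Set.Ici (0 : ℝ) := interior_subset hl
    rw [(hderiv l hl').1.deriv]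
    exact (hderiv l hl').2
  have hzero : g 0 = (x - y) ⬝ᵥ A.mulVec (x - y) - 1 := by
    rw [hg, hz]
    simp
  have hpos : 0 < g 0 := by
    rw [hzero]
    linarith
  have hlim : Tendsto g atTop (nhds (-1)) := by
    rw [hgf]
    simpa using (hA.tendsto_quadratic_resolvent (x - y)).sub_const 1
  refine ⟨hderiv, hanti, ⟨hzero, hpos⟩, hlim, ?_⟩
  obtain ⟨b, hb, hb0⟩ := ((hlim.eventually_lt_const (show (-1 : ℝ) < 0 by norm_num)).and
    (eventually_gt_atTop 0)).exists
  obtain ⟨c, hc, hgc⟩ := intermediate_value_Icc' hb0.le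
    (hcont.mono Set.Icc_subset_Ici_self) ⟨hb.le, hpos.le⟩
  have hc0 : 0 < c := by
    refine lt_of_le_of_ne hc.1 fun h => ?_
    rw [← h] at hgc
    exact hpos.ne' hgc
  exact ⟨c, ⟨hc0, hgc⟩, fun d hd => hanti.injOn hd.1.le hc0.le (hd.2.trans hgc.symm)⟩
end

section
/- Let M be a real 3×3 matrix with singular value decomposition M = U S Vᵀ, where U and V are 3×3 orthogonal matrices and S = diag(s₁, s₂, s₃) with s₁ ≥ s₂ ≥ s₃ ≥ 0. Define U₊ = U · diag(1, 1, det U) and V₊ = V · diag(1, 1, det V), which lie in SO(3). Then for every R ∈ SO(3), trace(Mᵀ R) ≤ s₁ + s₂ + s₃ · det(U) det(V), and equality is attained at R = U₊ V₊ᵀ. -/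
open Matrix

/-- `SO(3)`: real 3×3 matrices with `RᵀR = RRᵀ = I` and `det R = 1`. -/
def SO3 (R : Matrix (Fin 3) (Fin 3) ℝ) : Prop :=
  Rᵀ * R = 1 ∧ R * Rᵀ = 1 ∧ R.det = 1

theorem det_mul_det_of_transpose_mul_self {n : Type*} [Fintype n] [DecidableEq n]
    {U : Matrix n n ℝ} (hU : Uᵀ * U = 1) : U.det * U.det = 1 := by
  simpa using congrArg Matrix.det hU

/-- An orthogonal 3×3 matrix has trace at most `2 + det`. -/
theorem trace_le_two_add_det {Q : Matrix (Fin 3) (Fin 3) ℝ} (hQ : Qᵀ * Q = 1) :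
    Q.trace ≤ 2 + Q.det := by
  have hd : Q.det * Q.det = 1 :=
    det_mul_det_of_transpose_mul_self hQ
  have hadj : Q.adjugate = Q.det • Qᵀ := by
    calc Q.adjugate = Qᵀ * Q * Q.adjugate := by rw [hQ, Matrix.one_mul]
      _ = Q.det • Qᵀ := by
        rw [Matrix.mul_assoc, Matrix.mul_adjugate, Matrix.mul_smul, Matrix.mul_one]
  have hminors := congrArg Matrix.trace hadj
  have hnorm := congrArg Matrix.trace hQ
  rw [Matrix.adjugate_fin_three, Matrix.trace_smul, Matrix.trace_transpose] at hminors
  generalize Q.det = d at *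
  simp [Matrix.trace_fin_three, Matrix.mul_apply, Fin.sum_univ_three] at hminors hnorm ⊢
  have hsq : (Q 0 0 + Q 1 1 + Q 2 2 - d) ^ 2 ≤ 2 ^ 2 := by
    nlinarith [sq_nonneg (Q 0 1 - Q 1 0), sq_nonneg (Q 0 2 - Q 2 0),
      sq_nonneg (Q 1 2 - Q 2 1)]
  linarith [abs_le_of_sq_le_sq' hsq (by norm_num)]

theorem diag_le_one_of_transpose_mul_self {n : Type*} [Fintype n] [DecidableEq n]
    {Q : Matrix n n ℝ} (hQ : Qᵀ * Q = 1) (i : n) : Q i i ≤ 1 := by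
  have h : ∑ k, Q k i * Q k i = 1 := by
    simpa [Matrix.mul_apply] using congrFun (congrFun hQ i) i
  have hi : Q i i * Q i i ≤ ∑ k, Q k i * Q k i :=
    Finset.single_le_sum (f := fun k => Q k i * Q k i)
      (fun k _ => mul_self_nonneg _) (Finset.mem_univ i)
  nlinarith

theorem SO3_mul_diagonal_det {U : Matrix (Fin 3) (Fin 3) ℝ} (hU : Uᵀ * U = 1) :
    SO3 (U * Matrix.diagonal ![1, 1, U.det]) := by
  have hd := det_mul_det_of_transpose_mul_self hU
  have h : (U * Matrix.diagonal ![1, 1, U.det])ᵀ * (U * Matrix.diagonal ![1, 1, U.det]) = 1 := by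
    rw [Matrix.transpose_mul, Matrix.mul_assoc, ← Matrix.mul_assoc Uᵀ, hU, Matrix.one_mul,
      Matrix.diagonal_transpose, Matrix.diagonal_mul_diagonal, ← Matrix.diagonal_one]
    congr 1
    ext i
    fin_cases i <;> simp [hd]
  refine ⟨h, mul_eq_one_comm.mp h, ?_⟩
  simp [Matrix.det_mul, Matrix.det_diagonal, Fin.prod_univ_three, hd]

theorem trace_svd_transpose_mul (U V R : Matrix (Fin 3) (Fin 3) ℝ) (s₁ s₂ s₃ : ℝ) :
    ((U * Matrix.diagonal ![s₁, s₂, s₃] * Vᵀ)ᵀ * R).trace =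
      s₁ * (Uᵀ * R * V) 0 0 + s₂ * (Uᵀ * R * V) 1 1 + s₃ * (Uᵀ * R * V) 2 2 := by
  rw [Matrix.transpose_mul, Matrix.transpose_mul, Matrix.transpose_transpose,
    Matrix.diagonal_transpose, Matrix.mul_assoc, Matrix.trace_mul_comm, Matrix.mul_assoc,
    Matrix.mul_assoc, ← Matrix.mul_assoc Uᵀ, Matrix.trace_fin_three]
  simp [Matrix.diagonal_mul]

/-- **Trace maximization over SO(3)** (Lemma A1, rotation part).
Let `M = U S Vᵀ` be an SVD with `U, V` orthogonal and `S = diag(s₁,s₂,s₃)`,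
`s₁ ≥ s₂ ≥ s₃ ≥ 0`. With `U₊ = U·diag(1,1,det U)` and `V₊ = V·diag(1,1,det V)`
(both in `SO(3)`), one has `trace(MᵀR) ≤ s₁ + s₂ + s₃·det(U)det(V)` for all
`R ∈ SO(3)`, with equality at `R = U₊V₊ᵀ`. -/
theorem trace_max_over_SO3
    (M U V S : Matrix (Fin 3) (Fin 3) ℝ) (s₁ s₂ s₃ : ℝ)
    (hU : Uᵀ * U = 1) (hV : Vᵀ * V = 1)
    (hS : S = Matrix.diagonal ![s₁, s₂, s₃])
    (h12 : s₁ ≥ s₂) (h23 : s₂ ≥ s₃) (h3 : s₃ ≥ 0)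
    (hM : M = U * S * Vᵀ)
    (Up Vp : Matrix (Fin 3) (Fin 3) ℝ)
    (hUp : Up = U * Matrix.diagonal ![1, 1, U.det])
    (hVp : Vp = V * Matrix.diagonal ![1, 1, V.det]) :
    SO3 Up ∧ SO3 Vp ∧
    (∀ R : Matrix (Fin 3) (Fin 3) ℝ, SO3 R →
      (Mᵀ * R).trace ≤ s₁ + s₂ + s₃ * (U.det * V.det)) ∧
    (Mᵀ * (Up * Vpᵀ)).trace = s₁ + s₂ + s₃ * (U.det * V.det) := by
  subst hUp hVp hS hM
  refine ⟨SO3_mul_diagonal_det hU, SO3_mul_diagonal_det hV, ?_, ?_⟩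
  · rintro R ⟨hR, -, hRdet⟩
    have hQ : (Uᵀ * R * V)ᵀ * (Uᵀ * R * V) = 1 := by
      have hU' : U * Uᵀ = 1 := mul_eq_one_comm.mp hU
      calc (Uᵀ * R * V)ᵀ * (Uᵀ * R * V) = Vᵀ * (Rᵀ * (U * Uᵀ) * R) * V := by
            simp only [Matrix.transpose_mul, Matrix.transpose_transpose, Matrix.mul_assoc]
        _ = 1 := by rw [hU', Matrix.mul_one, hR, Matrix.mul_one, hV]
    have htr := trace_le_two_add_det hQ
    have hdet : (Uᵀ * R * V).det = U.det * V.det := by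
      simp [Matrix.det_mul, hRdet]
    have h0 := diag_le_one_of_transpose_mul_self hQ 0
    have h1 := diag_le_one_of_transpose_mul_self hQ 1
    rw [hdet, Matrix.trace_fin_three] at htr
    rw [trace_svd_transpose_mul]
    nlinarith [mul_le_mul_of_nonneg_left h0 (sub_nonneg.mpr h12),
      mul_le_mul_of_nonneg_left (add_le_add h0 h1) (sub_nonneg.mpr h23),
      mul_le_mul_of_nonneg_left htr h3]
  · have hQ : Uᵀ * (U * Matrix.diagonal ![1, 1, U.det] *
        (V * Matrix.diagonal ![1, 1, V.det])ᵀ) * V =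
        Matrix.diagonal ![1, 1, U.det] * Matrix.diagonal ![1, 1, V.det] := by
      calc _ = (Uᵀ * U) * Matrix.diagonal ![1, 1, U.det] *
            Matrix.diagonal ![1, 1, V.det] * (Vᵀ * V) := by
            simp only [Matrix.transpose_mul, Matrix.diagonal_transpose, Matrix.mul_assoc]
        _ = _ := by rw [hU, hV, Matrix.one_mul, Matrix.mul_one]
    rw [trace_svd_transpose_mul, hQ]
    simp
end

section
/- Let x̃₁, …, x̃_N and ỹ₁, …, ỹ_N be vectors in ℝ³, and suppose M = ∑_{i=1}^N ỹᵢ x̃ᵢᵀ factors as M = U₊ S′ V₊ᵀ with U₊, V₊ ∈ SO(3) and S′ a diagonal matrix. Then the total torque vanishes at the rotation R* = U₊ V₊ᵀ: ∑_{i=1}^N x̃ᵢ × ((R*)ᵀ ỹᵢ) = 0. In particular, the globally optimal rotation of point cloud registration is an equilibrium point of the spring-damped rigid-body dynamics. -/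
open Matrix

/-- The sum of the cross products `xᵢ × wᵢ` vanishes when `∑ᵢ wᵢxᵢᵀ` is symmetric. -/
theorem sum_crossProduct_eq_zero_of_isSymm {R ι : Type*} [CommRing R] [Fintype ι]
    (x w : ι → Fin 3 → R) (h : (∑ i, vecMulVec (w i) (x i)).IsSymm) :
    ∑ i, crossProduct (x i) (w i) = 0 := by
  have key (a b : Fin 3) : ∑ i, (x i a * w i b - x i b * w i a) = 0 := by
    have hab := h.apply a b
    simp only [Matrix.sum_apply, vecMulVec_apply] at hab
    rw [Finset.sum_sub_distrib, sub_eq_zero]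
    simpa only [mul_comm] using hab
  ext k
  fin_cases k <;> simp [Finset.sum_apply, cross_apply, key]

/-- **The optimal rotation is an equilibrium point** (Theorem 3, claim ①).
Let `x̃₁, …, x̃_N` and `ỹ₁, …, ỹ_N` be vectors in `ℝ³` and suppose
`M = ∑ᵢ ỹᵢx̃ᵢᵀ = U₊S′V₊ᵀ` with `U₊, V₊ ∈ SO(3)` and `S′` diagonal. Then the total
torque vanishes at `R* = U₊V₊ᵀ`: `∑ᵢ x̃ᵢ × ((R*)ᵀ ỹᵢ) = 0`. -/
theorem optimal_rotation_is_equilibrium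
    (N : ℕ) (xt yt : Fin N → Fin 3 → ℝ)
    (Up Vp Sp : Matrix (Fin 3) (Fin 3) ℝ)
    (hUp : SO3 Up) (hVp : SO3 Vp)
    (d : Fin 3 → ℝ) (hSp : Sp = Matrix.diagonal d)
    (hM : ∑ i, vecMulVec (yt i) (xt i) = Up * Sp * Vpᵀ) :
    ∑ i, crossProduct (xt i) ((Up * Vpᵀ)ᵀ.mulVec (yt i)) = 0 := by
  apply sum_crossProduct_eq_zero_of_isSymm
  have hsum : ∑ i, vecMulVec ((Up * Vpᵀ)ᵀ *ᵥ yt i) (xt i) = Vp * Sp * Vpᵀ := by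
    simp_rw [← mul_vecMulVec]
    rw [← Matrix.mul_sum, hM, transpose_mul, transpose_transpose, mul_assoc Vp,
      mul_assoc Up, ← mul_assoc Upᵀ, hUp.1, one_mul, mul_assoc]
  rw [hsum, hSp, Matrix.IsSymm]
  simp [transpose_mul, mul_assoc]
end
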